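/- For n = 4, con(Ω_{s,n} ∪ {φ^n_1,…,φ^n_n}) is a proper subset of con(Υ_{s,n}): there exists an s-Gaussian function on four variables that does not belong to the closed convex cone generated by the s-representable functions together with φ^4_1,…,φ^4_4 (indeed, one that violates an Ingleton inequality, which every function in that cone satisfies). -/

import Mathlib

open MeasureTheory

noncomputable section

/-- The principal submatrix of `K` with rows and columns indexed by `α`. -/
def principalSub {n : ℕ} (K : Matrix (Fin n) (Fin n) ℝ) (α : Finset (Fin n)) :
    Matrix {i // i ∈ α} {i // i ∈ α} ℝ :=
  K.submatrix (fun i => i.1) (fun i => i.1)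

/-- A closed convex cone: a closed convex set stable under positive scaling. -/
def IsClosedConvexCone {E : Type*} [AddCommMonoid E] [Module ℝ E] [TopologicalSpace E]
    (C : Set E) : Prop :=
  IsClosed C ∧ Convex ℝ C ∧ ∀ c : ℝ, 0 < c → ∀ x ∈ C, c • x ∈ C

/-- `ccc S` is the smallest closed convex cone containing `S`. -/
def ccc {E : Type*} [AddCommMonoid E] [Module ℝ E] [TopologicalSpace E] (S : Set E) : Set E :=
  ⋂₀ {C : Set E | IsClosedConvexCone C ∧ S ⊆ C}

/-- `Wscale S` is the set of positive scalar multiples of elements of `S`. -/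
def Wscale {E : Type*} [SMul ℝ E] (S : Set E) : Set E :=
  {h | ∃ c : ℝ, 0 < c ∧ ∃ g ∈ S, h = c • g}

/-- The rank function `φⁿᵢ`. -/
def phiFn (n : ℕ) (i : Fin n) : Finset (Fin n) → ℝ :=
  fun α => if i ∈ α then -1 else 0

/-- s-Gaussian rank functions: differential entropy functions of `n` jointly Gaussian
scalar random variables with positive definite covariance matrix. -/
def IsSGaussian (n : ℕ) (g : Finset (Fin n) → ℝ) : Prop :=
  ∃ K : Matrix (Fin n) (Fin n) ℝ, K.PosDef ∧
    ∀ α : Finset (Fin n),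
      g α = 1 / 2 * Real.logb 2
        ((2 * Real.pi * Real.exp 1) ^ α.card * (principalSub K α).det)

/-- The principal submatrix on the blocks indexed by `α`. -/
def vPrincipal {n : ℕ} {k : Fin n → ℕ}
    (K : Matrix ((i : Fin n) × Fin (k i)) ((i : Fin n) × Fin (k i)) ℝ)
    (α : Finset (Fin n)) :
    Matrix {p : (i : Fin n) × Fin (k i) // p.1 ∈ α}
      {p : (i : Fin n) × Fin (k i) // p.1 ∈ α} ℝ :=
  K.submatrix (fun p => p.1) (fun p => p.1)

/-- v-Gaussian rank functions: differential entropy functions of `n` jointly Gaussian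
random vectors of positive lengths `k i`, with positive definite joint covariance. -/
def IsVGaussian (n : ℕ) (g : Finset (Fin n) → ℝ) : Prop :=
  ∃ k : Fin n → ℕ, (∀ i, 0 < k i) ∧
    ∃ K : Matrix ((i : Fin n) × Fin (k i)) ((i : Fin n) × Fin (k i)) ℝ, K.PosDef ∧
      ∀ α : Finset (Fin n),
        g α = 1 / 2 * Real.logb 2
          ((2 * Real.pi * Real.exp 1) ^ (∑ i ∈ α, k i) * (vPrincipal K α).det)

/-- Normalised Gaussian entropy functions: all blocks have common length `T`, and the
entropy function is multiplied by `1/T`. -/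
def IsNormGaussian (n : ℕ) (g : Finset (Fin n) → ℝ) : Prop :=
  ∃ T : ℕ, 0 < T ∧
    ∃ K : Matrix (Fin n × Fin T) (Fin n × Fin T) ℝ, K.PosDef ∧
      ∀ α : Finset (Fin n),
        g α = (1 / (T : ℝ)) * (1 / 2 * Real.logb 2
          ((2 * Real.pi * Real.exp 1) ^ (T * α.card) *
            (K.submatrix (fun p : {p : Fin n × Fin T // p.1 ∈ α} => p.1)
              (fun p => p.1)).det))

/-- `g` is the differential entropy function of scalar random variables `X`:
the joint law has a density, every nonempty subtuple has a density whose entropy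
integrand is integrable, `g ∅ = 0`, and `g α = h(X_α)` (base-2). -/
def SEntropyData (n : ℕ) (Ω : Type) [MeasureSpace Ω] (X : Fin n → Ω → ℝ)
    (g : Finset (Fin n) → ℝ) : Prop :=
  IsProbabilityMeasure (volume : Measure Ω) ∧
  Measurable (fun ω i => X i ω) ∧
  (∃ f : (Fin n → ℝ) → ℝ, Measurable f ∧ (∀ x, 0 ≤ f x) ∧
    Measure.map (fun ω i => X i ω) volume
      = volume.withDensity fun x => ENNReal.ofReal (f x)) ∧
  g ∅ = 0 ∧
  ∀ α : Finset (Fin n), α.Nonempty →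
    ∃ f : ({i // i ∈ α} → ℝ) → ℝ, Measurable f ∧ (∀ x, 0 ≤ f x) ∧
      Measure.map (fun ω (i : {i // i ∈ α}) => X i.1 ω) volume
        = volume.withDensity (fun x => ENNReal.ofReal (f x)) ∧
      Integrable (fun x => f x * Real.logb 2 (f x)) ∧
      g α = -∫ x, f x * Real.logb 2 (f x)

/-- s-entropic rank functions. -/
def IsSEntropic (n : ℕ) (g : Finset (Fin n) → ℝ) : Prop :=
  ∃ (Ω : Type) (m : MeasureSpace Ω) (X : Fin n → Ω → ℝ), @SEntropyData n Ω m X g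

/-- `g` is the differential entropy function of random vectors `X i : Ω → ℝ^{k i}`. -/
def VEntropyData (n : ℕ) (k : Fin n → ℕ) (Ω : Type) [MeasureSpace Ω]
    (X : (i : Fin n) → Ω → (Fin (k i) → ℝ)) (g : Finset (Fin n) → ℝ) : Prop :=
  IsProbabilityMeasure (volume : Measure Ω) ∧
  Measurable (fun ω (i : Fin n) => X i ω) ∧
  (∃ f : ((i : Fin n) → Fin (k i) → ℝ) → ℝ, Measurable f ∧ (∀ x, 0 ≤ f x) ∧
    Measure.map (fun ω (i : Fin n) => X i ω) volume
      = volume.withDensity fun x => ENNReal.ofReal (f x)) ∧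
  g ∅ = 0 ∧
  ∀ α : Finset (Fin n), α.Nonempty →
    ∃ f : ((i : {i // i ∈ α}) → Fin (k i.1) → ℝ) → ℝ, Measurable f ∧ (∀ x, 0 ≤ f x) ∧
      Measure.map (fun ω (i : {i // i ∈ α}) => X i.1 ω) volume
        = volume.withDensity (fun x => ENNReal.ofReal (f x)) ∧
      Integrable (fun x => f x * Real.logb 2 (f x)) ∧
      g α = -∫ x, f x * Real.logb 2 (f x)

/-- v-entropic rank functions. -/
def IsVEntropic (n : ℕ) (g : Finset (Fin n) → ℝ) : Prop :=
  ∃ k : Fin n → ℕ, (∀ i, 0 < k i) ∧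
    ∃ (Ω : Type) (m : MeasureSpace Ω) (X : (i : Fin n) → Ω → (Fin (k i) → ℝ)),
      @VEntropyData n k Ω m X g

/-- s-representable rank functions. -/
def IsSRepresentable (n : ℕ) (g : Finset (Fin n) → ℝ) : Prop :=
  ∃ (k : ℕ) (A : Fin n → Fin k → ℝ),
    ∀ α : Finset (Fin n),
      g α = (Module.finrank ℝ ↥(Submodule.span ℝ (A '' (α : Set (Fin n)))) : ℝ)

/-- v-representable rank functions. -/
def IsVRepresentable (n : ℕ) (g : Finset (Fin n) → ℝ) : Prop :=
  ∃ (d : ℕ) (k : Fin n → ℕ) (A : (i : Fin n) → Fin (k i) → (Fin d → ℝ)),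
    ∀ α : Finset (Fin n),
      g α = (Module.finrank ℝ
        ↥(Submodule.span ℝ {v : Fin d → ℝ | ∃ i ∈ α, ∃ j, v = A i j}) : ℝ)

/-- The marginal probability mass function of a joint pmf `p` on the coordinates in `α`. -/
def marginalPMF {n : ℕ} (S : Fin n → ℕ) (p : ((i : Fin n) → Fin (S i)) → ℝ)
    (α : Finset (Fin n)) (x : (i : {i // i ∈ α}) → Fin (S i.1)) : ℝ :=
  ∑ y : (i : Fin n) → Fin (S i), if ∀ i : {i // i ∈ α}, y i.1 = x i then p y else 0

/-- The Shannon entropy (base 2) of the subtuple indexed by `α`. -/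
def discEntropyFn {n : ℕ} (S : Fin n → ℕ) (p : ((i : Fin n) → Fin (S i)) → ℝ)
    (α : Finset (Fin n)) : ℝ :=
  -∑ x : (i : {i // i ∈ α}) → Fin (S i.1),
    marginalPMF S p α x * Real.logb 2 (marginalPMF S p α x)

/-- Entropic rank functions: Shannon entropy functions of finitely-valued
discrete random variables. -/
def IsEntropic (n : ℕ) (g : Finset (Fin n) → ℝ) : Prop :=
  ∃ (S : Fin n → ℕ) (p : ((i : Fin n) → Fin (S i)) → ℝ),
    (∀ x, 0 ≤ p x) ∧ (∑ x, p x = 1) ∧ ∀ α, g α = discEntropyFn S p α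

/-- The Ingleton inequality for a rank function on four variables. -/
def IngletonIneq (g : Finset (Fin 4) → ℝ) (i j k l : Fin 4) : Prop :=
  g {i} + g {j} + g {k, l} + g {i, j, k} + g {i, j, l} ≤
    g {i, j} + g {i, k} + g {i, l} + g {j, k} + g {j, l}

open Filter Topology

section Cone

variable {E : Type*} [AddCommMonoid E] [Module ℝ E] [TopologicalSpace E]

theorem subset_ccc (S : Set E) : S ⊆ ccc S :=
  Set.subset_sInter fun _ hC => hC.2

theorem ccc_subset {S C : Set E} (hC : IsClosedConvexCone C) (h : S ⊆ C) : ccc S ⊆ C :=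
  Set.sInter_subset_of_mem ⟨hC, h⟩

theorem isClosedConvexCone_ccc (S : Set E) : IsClosedConvexCone (ccc S) := by
  refine ⟨isClosed_sInter fun C hC => hC.1.1, convex_sInter fun C hC => hC.1.2.1, ?_⟩
  intro c hc x hx C hC
  exact hC.1.2.2 c hc x (hx C hC)

end Cone

section Ingleton

/-- Ingleton's inequality for subspaces of a finite-dimensional vector space. -/
theorem finrank_ingleton {F V : Type*} [Field F] [AddCommGroup V] [Module F V]
    [FiniteDimensional F V] (A B C D : Submodule F V) :
    Module.finrank F A + Module.finrank F B + Module.finrank F ↥(C ⊔ D) +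
        Module.finrank F ↥(A ⊔ B ⊔ C) + Module.finrank F ↥(A ⊔ B ⊔ D) ≤
      Module.finrank F ↥(A ⊔ B) + Module.finrank F ↥(A ⊔ C) + Module.finrank F ↥(A ⊔ D) +
        Module.finrank F ↥(B ⊔ C) + Module.finrank F ↥(B ⊔ D) := by
  have common (U : Submodule F V) :
      Module.finrank F ↥(A ⊔ B ⊔ U) + Module.finrank F ↥(A ⊓ B ⊔ U) ≤
        Module.finrank F ↥(A ⊔ U) + Module.finrank F ↥(B ⊔ U) := by
    rw [← Submodule.finrank_sup_add_finrank_inf_eq (A ⊔ U) (B ⊔ U), ← sup_sup_distrib_right]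
    gcongr
    exact Submodule.finrank_mono (le_inf (sup_le_sup_right inf_le_left _)
      (sup_le_sup_right inf_le_right _))
  have hAB := Submodule.finrank_sup_add_finrank_inf_eq A B
  have hC := common C
  have hD := common D
  have hW := Submodule.finrank_sup_add_finrank_inf_eq (A ⊓ B ⊔ C) (A ⊓ B ⊔ D)
  have h₁ : Module.finrank F ↥(C ⊔ D) ≤ Module.finrank F ↥(A ⊓ B ⊔ C ⊔ (A ⊓ B ⊔ D)) :=
    Submodule.finrank_mono (sup_le_sup le_sup_right le_sup_right)
  have h₂ : Module.finrank F ↥(A ⊓ B) ≤ Module.finrank F ↥((A ⊓ B ⊔ C) ⊓ (A ⊓ B ⊔ D)) :=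
    Submodule.finrank_mono (le_inf le_sup_left le_sup_left)
  omega

theorem IsSRepresentable.ingletonIneq {g : Finset (Fin 4) → ℝ} (hg : IsSRepresentable 4 g)
    (i j k l : Fin 4) : IngletonIneq g i j k l := by
  obtain ⟨m, A, hA⟩ := hg
  let S (a : Fin 4) : Submodule ℝ (Fin m → ℝ) := Submodule.span ℝ {A a}
  have h₁ (a) : g {a} = Module.finrank ℝ (S a) := by
    rw [hA, Finset.coe_singleton, Set.image_singleton]
  have h₂ (a b) : g {a, b} = Module.finrank ℝ ↥(S a ⊔ S b) := by
    rw [hA, Finset.coe_insert, Set.image_insert_eq, Submodule.span_insert,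
      Finset.coe_singleton, Set.image_singleton]
  have h₃ (a b c) : g {a, b, c} = Module.finrank ℝ ↥(S a ⊔ S b ⊔ S c) := by
    rw [hA, Finset.coe_insert, Set.image_insert_eq, Submodule.span_insert, Finset.coe_insert,
      Set.image_insert_eq, Submodule.span_insert, Finset.coe_singleton, Set.image_singleton,
      ← sup_assoc]
  simp only [IngletonIneq, h₁, h₂, h₃]
  exact_mod_cast finrank_ingleton (S i) (S j) (S k) (S l)

theorem phiFn_ingletonIneq {i j k l : Fin 4} (hij : i ≠ j) (hik : i ≠ k) (hil : i ≠ l)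
    (hjk : j ≠ k) (hjl : j ≠ l) (hkl : k ≠ l) (m : Fin 4) :
    IngletonIneq (phiFn 4 m) i j k l := by
  simp only [IngletonIneq, phiFn, Finset.mem_insert, Finset.mem_singleton]
  by_cases h₁ : m = i
  · subst h₁; simp [hij, hik, hil]
  by_cases h₂ : m = j
  · subst h₂; simp [hij.symm, hjk, hjl]
  by_cases h₃ : m = k
  · subst h₃; simp [hik.symm, hjk.symm, hkl]
  by_cases h₄ : m = l
  · subst h₄; simp [hil.symm, hjl.symm, hkl.symm]
  simp [h₁, h₂, h₃, h₄]

theorem isClosedConvexCone_ingletonIneq (i j k l : Fin 4) :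
    IsClosedConvexCone {g : Finset (Fin 4) → ℝ | IngletonIneq g i j k l} := by
  refine ⟨isClosed_le (by fun_prop) (by fun_prop), ?_, ?_⟩
  · intro x hx y hy a b ha hb _
    simp only [Set.mem_ofPred_eq, IngletonIneq, Pi.add_apply, Pi.smul_apply, smul_eq_mul] at *
    nlinarith [mul_le_mul_of_nonneg_left hx ha, mul_le_mul_of_nonneg_left hy hb]
  · intro c hc x hx
    simp only [Set.mem_ofPred_eq, IngletonIneq, Pi.smul_apply, smul_eq_mul] at *
    nlinarith [mul_le_mul_of_nonneg_left hx hc.le]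

theorem ingletonIneq_of_mem_ccc {h : Finset (Fin 4) → ℝ}
    (hh : h ∈ ccc ({g : Finset (Fin 4) → ℝ | IsSRepresentable 4 g} ∪
      {g | ∃ i : Fin 4, g = phiFn 4 i}))
    {i j k l : Fin 4} (hij : i ≠ j) (hik : i ≠ k) (hil : i ≠ l)
    (hjk : j ≠ k) (hjl : j ≠ l) (hkl : k ≠ l) : IngletonIneq h i j k l := by
  refine ccc_subset (isClosedConvexCone_ingletonIneq i j k l) ?_ hh
  rintro g (hg | ⟨m, rfl⟩)
  · exact IsSRepresentable.ingletonIneq hg i j k l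
  · exact phiFn_ingletonIneq hij hik hil hjk hjl hkl m

end Ingleton

/-- The principal minor of `K` indexed by `α`. -/
def principalMinor {n : ℕ} (K : Matrix (Fin n) (Fin n) ℝ) (α : Finset (Fin n)) : ℝ :=
  (principalSub K α).det

section Limits

variable {n : ℕ}

theorem principalSub_det_pos {K : Matrix (Fin n) (Fin n) ℝ} (hK : K.PosDef)
    (α : Finset (Fin n)) : 0 < (principalSub K α).det :=
  (hK.submatrix Subtype.val_injective).det_pos

theorem gaussian_entropy_eq {K : Matrix (Fin n) (Fin n) ℝ} (hK : K.PosDef)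
    (α : Finset (Fin n)) :
    1 / 2 * Real.logb 2 ((2 * Real.pi * Real.exp 1) ^ α.card * (principalSub K α).det) =
      1 / 2 * (α.card * Real.logb 2 (2 * Real.pi * Real.exp 1) +
        Real.logb 2 (principalMinor K α)) := by
  rw [principalMinor, Real.logb_mul (by positivity) (principalSub_det_pos hK α).ne', Real.logb_pow]

/-- The exponential growth rates of the principal minors of a family of covariance matrices
form a limit of scaled Gaussian entropy functions. -/
theorem mem_ccc_isSGaussian_of_tendsto {K : ℝ → Matrix (Fin n) (Fin n) ℝ}
    {r : Finset (Fin n) → ℝ} (hK : ∀ t, 1 < t → (K t).PosDef)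
    (hr : ∀ α, Tendsto (fun t => Real.log (principalSub (K t) α).det / Real.log t) atTop
      (𝓝 (r α))) :
    r ∈ ccc {g : Finset (Fin n) → ℝ | IsSGaussian n g} := by
  have hC := isClosedConvexCone_ccc {g : Finset (Fin n) → ℝ | IsSGaussian n g}
  refine hC.1.mem_of_tendsto (b := atTop) (f := fun t : ℝ => (1 / 2 * Real.logb 2 t)⁻¹ •
    fun α : Finset (Fin n) => 1 / 2 * Real.logb 2
      ((2 * Real.pi * Real.exp 1) ^ α.card * (principalSub (K t) α).det)) ?_ ?_
  · rw [tendsto_pi_nhds]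
    intro α
    have h₀ : Tendsto (fun t => α.card * Real.log (2 * Real.pi * Real.exp 1) / Real.log t)
        atTop (𝓝 0) := Real.tendsto_log_atTop.const_div_atTop _
    have h := h₀.add (hr α)
    rw [zero_add] at h
    refine h.congr' ?_
    filter_upwards [eventually_gt_atTop 1] with t ht
    have hlog : Real.log t ≠ 0 := (Real.log_pos ht).ne'
    have hlog2 : Real.log 2 ≠ 0 := (Real.log_pos one_lt_two).ne'
    rw [Pi.smul_apply, smul_eq_mul, gaussian_entropy_eq (hK t ht)]
    simp only [Real.logb, principalMinor]
    field_simp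
  · filter_upwards [eventually_gt_atTop 1] with t ht
    refine hC.2.2 _ ?_ _ (subset_ccc _ ⟨K t, hK t ht, fun _ => rfl⟩)
    have := Real.logb_pos one_lt_two ht
    positivity

theorem phiFn_mem_ccc_isSGaussian (i : Fin n) :
    phiFn n i ∈ ccc {g : Finset (Fin n) → ℝ | IsSGaussian n g} := by
  refine mem_ccc_isSGaussian_of_tendsto
    (K := fun t => Matrix.diagonal fun j => if j = i then t⁻¹ else 1) ?_ ?_
  · intro t ht
    refine Matrix.PosDef.diagonal fun j => ?_
    split_ifs <;> positivity
  · intro α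
    refine tendsto_const_nhds.congr' ?_
    filter_upwards [eventually_gt_atTop 1] with t ht
    have hlog : Real.log t ≠ 0 := (Real.log_pos ht).ne'
    rw [principalSub, Matrix.submatrix_diagonal _ _ Subtype.val_injective, Matrix.det_diagonal]
    simp only [Function.comp_apply]
    rw [Finset.prod_coe_sort α (fun j => if j = i then t⁻¹ else 1), Finset.prod_ite_eq', phiFn]
    split_ifs
    · rw [Real.log_inv, neg_div, div_self hlog]
    · simp

theorem det_one_add_smul_eq_prod {m : Type*} [Fintype m] [DecidableEq m] {G : Matrix m m ℝ}
    (hG : G.IsHermitian) {t : ℝ} (ht : t ≠ 0) :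
    (1 + t • G).det = ∏ i, (1 + t * hG.eigenvalues i) := by
  have h₁ : 1 + t • G = (-t) • (Matrix.scalar m (-t⁻¹) - G) := by
    ext a b
    by_cases hab : a = b
    · subst hab; simp; field_simp; ring
    · simp [hab]
  rw [h₁, Matrix.det_smul, ← Matrix.eval_charpoly, hG.charpoly_eq, Polynomial.eval_prod,
    Fintype.card, ← Finset.prod_const, ← Finset.prod_mul_distrib]
  refine Finset.prod_congr rfl fun i _ => ?_
  simp
  field_simp
  ring

theorem tendsto_log_one_add_mul_div_log {a : ℝ} (ha : 0 < a) :
    Tendsto (fun t => Real.log (1 + t * a) / Real.log t) atTop (𝓝 1) := by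
  have h₁ : Tendsto (fun t : ℝ => Real.log (t⁻¹ + a)) atTop (𝓝 (Real.log (0 + a))) :=
    (tendsto_inv_atTop_zero.add_const a).log (by simpa using ha.ne')
  have h₂ := (h₁.div_atTop Real.tendsto_log_atTop).const_add 1
  rw [add_zero] at h₂
  refine h₂.congr' ?_
  filter_upwards [eventually_gt_atTop 1] with t ht
  have hlog : Real.log t ≠ 0 := (Real.log_pos ht).ne'
  have h₃ : 1 + t * a = t * (t⁻¹ + a) := by field_simp
  rw [h₃, Real.log_mul (by positivity) (by positivity)]
  field_simp

theorem tendsto_log_det_one_add_smul {m : Type*} [Fintype m] [DecidableEq m]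
    {G : Matrix m m ℝ} (hG : G.PosSemidef) :
    Tendsto (fun t : ℝ => Real.log (1 + t • G).det / Real.log t) atTop (𝓝 G.rank) := by
  classical
  have hsum : (G.rank : ℝ) = ∑ i, if hG.1.eigenvalues i ≠ 0 then 1 else 0 := by
    rw [hG.1.rank_eq_card_non_zero_eigs, Fintype.card_subtype, Finset.sum_boole]
  rw [hsum]
  have h : Tendsto (fun t : ℝ => ∑ i, Real.log (1 + t * hG.1.eigenvalues i) / Real.log t) atTop
      (𝓝 (∑ i, if hG.1.eigenvalues i ≠ 0 then 1 else 0)) := by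
    refine tendsto_finsetSum _ fun i _ => ?_
    split_ifs with hi
    · exact tendsto_log_one_add_mul_div_log ((hG.eigenvalues_nonneg i).lt_of_ne' hi)
    · simp [not_not.mp hi]
  refine h.congr' ?_
  filter_upwards [eventually_gt_atTop 1] with t ht
  rw [det_one_add_smul_eq_prod hG.1 (by positivity), Real.log_prod, Finset.sum_div]
  intro i _
  have := hG.eigenvalues_nonneg i
  positivity

theorem posDef_one_add_smul_mul_transpose {m k : Type*} [Fintype m] [DecidableEq m] [Fintype k]
    (M : Matrix m k ℝ) {t : ℝ} (ht : 0 ≤ t) : (1 + t • (M * M.transpose)).PosDef := by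
  refine Matrix.PosDef.one.add_posSemidef (Matrix.PosSemidef.smul ?_ ht)
  simpa using Matrix.posSemidef_self_mul_conjTranspose M

theorem IsSRepresentable.mem_ccc_isSGaussian {g : Finset (Fin n) → ℝ}
    (hg : IsSRepresentable n g) : g ∈ ccc {g : Finset (Fin n) → ℝ | IsSGaussian n g} := by
  obtain ⟨k, A, hA⟩ := hg
  refine mem_ccc_isSGaussian_of_tendsto
    (K := fun t => 1 + t • (Matrix.of A * (Matrix.of A).transpose)) ?_ ?_
  · intro t ht
    exact posDef_one_add_smul_mul_transpose _ (by positivity)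
  · intro α
    let M : Matrix {i // i ∈ α} (Fin k) ℝ := Matrix.of fun i => A i.1
    have hsub (t : ℝ) : principalSub (1 + t • (Matrix.of A * (Matrix.of A).transpose)) α =
        1 + t • (M * M.transpose) := by
      ext a b
      change (1 : Matrix (Fin n) (Fin n) ℝ) a.1 b.1 + _ = (1 : Matrix _ _ ℝ) a b + _
      congr 1
      simp only [Matrix.one_apply, Subtype.coe_inj]
    have hrow : A '' (α : Set (Fin n)) = Set.range M.row := Set.image_eq_range A α
    have hrank : g α = (M * M.transpose).rank := by
      rw [hA, Matrix.rank_self_mul_transpose, Matrix.rank_eq_finrank_span_row, hrow]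
    simp only [hsub, hrank]
    refine tendsto_log_det_one_add_smul ?_
    simpa using Matrix.posSemidef_self_mul_conjTranspose M

end Limits

section Violation

theorem principalMinor_eq {n m : ℕ} (K : Matrix (Fin n) (Fin n) ℝ) (α : Finset (Fin n))
    (f : Fin m → Fin n) (hf : Function.Injective f) (hα : Finset.univ.image f = α) :
    principalMinor K α = (K.submatrix f f).det := by
  have hmem (a : Fin m) : f a ∈ α := hα ▸ Finset.mem_image_of_mem f (Finset.mem_univ a)
  let e : Fin m ≃ {i // i ∈ α} := Equiv.ofBijective (fun a => ⟨f a, hmem a⟩)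
    ⟨fun a b h => hf (Subtype.ext_iff.mp h), by
      rintro ⟨i, hi⟩
      rw [← hα, Finset.mem_image] at hi
      obtain ⟨a, _, rfl⟩ := hi
      exact ⟨a, rfl⟩⟩
  rw [principalMinor, ← Matrix.det_submatrix_equiv_self e]
  rfl

/-- A Gaussian entropy function violates Ingleton's inequality if the principal minors violate
its multiplicative form. -/
theorem not_ingletonIneq_gaussian {K : Matrix (Fin 4) (Fin 4) ℝ} (hK : K.PosDef)
    (h : principalMinor K {0, 1} * principalMinor K {0, 2} *
        principalMinor K {0, 3} * principalMinor K {1, 2} *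
        principalMinor K {1, 3} <
      principalMinor K {0} * principalMinor K {1} * principalMinor K {2, 3} *
        principalMinor K {0, 1, 2} * principalMinor K {0, 1, 3}) :
    ¬ IngletonIneq (fun α => 1 / 2 * Real.logb 2
      ((2 * Real.pi * Real.exp 1) ^ α.card * (principalSub K α).det)) 0 1 2 3 := by
  have hpos (α : Finset (Fin 4)) : 0 < principalMinor K α := principalSub_det_pos hK α
  have hlogb (α β γ δ ε : Finset (Fin 4)) :
      Real.logb 2 (principalMinor K α * principalMinor K β * principalMinor K γ *
        principalMinor K δ * principalMinor K ε) =
      Real.logb 2 (principalMinor K α) + Real.logb 2 (principalMinor K β) +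
        Real.logb 2 (principalMinor K γ) + Real.logb 2 (principalMinor K δ) +
        Real.logb 2 (principalMinor K ε) := by
    have hα := hpos α
    have hβ := hpos β
    have hγ := hpos γ
    have hδ := hpos δ
    have hε := hpos ε
    rw [Real.logb_mul, Real.logb_mul, Real.logb_mul, Real.logb_mul] <;> positivity
  have hlog := Real.logb_lt_logb one_lt_two (mul_pos (mul_pos (mul_pos (mul_pos (hpos _)
    (hpos _)) (hpos _)) (hpos _)) (hpos _)) h
  rw [hlogb, hlogb] at hlog
  have hcard₁ (a : Fin 4) : ({a} : Finset (Fin 4)).card = 1 := Finset.card_singleton a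
  have hcard₂ {a b : Fin 4} (h : a ≠ b) : ({a, b} : Finset (Fin 4)).card = 2 :=
    Finset.card_pair h
  have hcard₃ {c : Fin 4} (h₀ : 0 ≠ c) (h₁ : 1 ≠ c) :
      ({0, 1, c} : Finset (Fin 4)).card = 3 := Finset.card_eq_three.mpr
    ⟨0, 1, c, by decide, h₀, h₁, rfl⟩
  simp only [IngletonIneq, gaussian_entropy_eq hK, not_le]
  rw [hcard₁, hcard₁, hcard₂ (by decide), hcard₂ (by decide), hcard₂ (by decide),
    hcard₂ (by decide), hcard₂ (by decide), hcard₂ (by decide), hcard₃ (by decide) (by decide),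
    hcard₃ (by decide) (by decide)]
  push_cast
  linarith

theorem exists_isSGaussian_not_ingletonIneq :
    ∃ g : Finset (Fin 4) → ℝ, IsSGaussian 4 g ∧ ¬ IngletonIneq g 0 1 2 3 := by
  let K : Matrix (Fin 4) (Fin 4) ℝ := !![2, 1, -2, -2; 1, 2, -2, -2; -2, -2, 6, 2; -2, -2, 2, 9]
  have hK : K.PosDef := by
    have h := posDef_one_add_smul_mul_transpose
      (!![0, 1; 0, 1; -1, -2; 2, -2] : Matrix (Fin 4) (Fin 2) ℝ) zero_le_one
    convert h
    ext a b
    rw [Matrix.add_apply, Matrix.smul_apply, Matrix.mul_apply, Fin.sum_univ_two]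
    fin_cases a <;> fin_cases b <;> simp [K] <;> norm_num
  refine ⟨_, ⟨K, hK, fun _ => rfl⟩, not_ingletonIneq_gaussian hK ?_⟩
  rw [principalMinor_eq K {0} ![0] (by decide) (by decide),
    principalMinor_eq K {1} ![1] (by decide) (by decide),
    principalMinor_eq K {2, 3} ![2, 3] (by decide) (by decide),
    principalMinor_eq K {0, 1, 2} ![0, 1, 2] (by decide) (by decide),
    principalMinor_eq K {0, 1, 3} ![0, 1, 3] (by decide) (by decide),
    principalMinor_eq K {0, 1} ![0, 1] (by decide) (by decide),
    principalMinor_eq K {0, 2} ![0, 2] (by decide) (by decide),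
    principalMinor_eq K {0, 3} ![0, 3] (by decide) (by decide),
    principalMinor_eq K {1, 2} ![1, 2] (by decide) (by decide),
    principalMinor_eq K {1, 3} ![1, 3] (by decide) (by decide)]
  simp only [Matrix.det_fin_one, Matrix.det_fin_two, Matrix.det_fin_three,
    Matrix.submatrix_apply]
  simp [K]
  norm_num

end Violation

/-- for `n = 4`, `con(Ω_{s,4} ∪ {φ⁴₁,…,φ⁴₄})` is a proper subset of
`con(Υ_{s,4})`: every function in the former cone satisfies all Ingleton inequalities,
and there is an s-Gaussian function outside the cone which violates an Ingleton
inequality. -/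
theorem stmt8 :
    ccc ({g : Finset (Fin 4) → ℝ | IsSRepresentable 4 g} ∪
        {g | ∃ i : Fin 4, g = phiFn 4 i}) ⊂
      ccc {g : Finset (Fin 4) → ℝ | IsSGaussian 4 g} ∧
    (∀ h ∈ ccc ({g : Finset (Fin 4) → ℝ | IsSRepresentable 4 g} ∪
        {g | ∃ i : Fin 4, g = phiFn 4 i}),
      ∀ i j k l : Fin 4, i ≠ j → i ≠ k → i ≠ l → j ≠ k → j ≠ l → k ≠ l →
        IngletonIneq h i j k l) ∧
    ∃ g : Finset (Fin 4) → ℝ, IsSGaussian 4 g ∧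
      g ∉ ccc ({g : Finset (Fin 4) → ℝ | IsSRepresentable 4 g} ∪
        {g | ∃ i : Fin 4, g = phiFn 4 i}) ∧
      ∃ i j k l : Fin 4, i ≠ j ∧ i ≠ k ∧ i ≠ l ∧ j ≠ k ∧ j ≠ l ∧ k ≠ l ∧
        ¬ IngletonIneq g i j k l := by
  obtain ⟨g, hg, hI⟩ := exists_isSGaussian_not_ingletonIneq
  have hmem : g ∉ ccc ({g : Finset (Fin 4) → ℝ | IsSRepresentable 4 g} ∪
      {g | ∃ i : Fin 4, g = phiFn 4 i}) := fun h =>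
    hI (ingletonIneq_of_mem_ccc h (by decide) (by decide) (by decide) (by decide) (by decide)
      (by decide))
  refine ⟨⟨ccc_subset (isClosedConvexCone_ccc _) ?_, fun h => hmem (h (subset_ccc _ hg))⟩,
    fun h hh i j k l hij hik hil hjk hjl hkl =>
      ingletonIneq_of_mem_ccc hh hij hik hil hjk hjl hkl,
    g, hg, hmem, 0, 1, 2, 3, by decide, by decide, by decide, by decide, by decide, by decide, hI⟩
  rintro h (hh | ⟨i, rfl⟩)
  · exact IsSRepresentable.mem_ccc_isSGaussian hh
  · exact phiFn_mem_ccc_isSGaussian i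

end
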